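/- arXiv:1601.03163 — 2 statements merged into one kernel-verified Lean document; each statement's English description precedes it below -/
import Mathlib

section
/- Let X be an α-favorable topological space (the player α has a winning strategy in the Choquet game on X), let Y be a Baire space, and let f : X × Y → ℝ be quasicontinuous in the first variable, continuous in the second variable, and discontinuous at every point of X × Y. Then there exists a sequence (yₙ) of points of Y such that for every subset N ⊆ ℕ there is a continuous function g : Y → [0,1] with g(yₙ) = 1 for n ∈ N and g(yₙ) = 0 for n ∉ N. -/
/-- Quasicontinuity of a map between topological spaces. -/
def IsQuasicontinuous {X Z : Type*} [TopologicalSpace X] [TopologicalSpace Z]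
    (f : X → Z) : Prop :=
  ∀ x₀ : X, ∀ U ∈ nhds x₀, ∀ V ∈ nhds (f x₀),
    ∃ U₁ : Set X, IsOpen U₁ ∧ U₁.Nonempty ∧ U₁ ⊆ U ∧ ∀ x ∈ U₁, f x ∈ V

/-- `X` is α-favorable: the player α has a winning strategy in the Choquet game on `X`.
A strategy for α is a function `σ` assigning to each history of moves of β (a list of
open nonempty sets, most recent first) an open nonempty subset of β's last move; it is
winning if for every run `U 0 ⊇ σ [U 0] ⊇ U 1 ⊇ σ [U 1, U 0] ⊇ …` consistent with `σ`,
the intersection `⋂ n, U n` is nonempty. -/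
def IsAlphaFavorable (X : Type*) [TopologicalSpace X] : Prop :=
  ∃ σ : List (Set X) → Set X,
    (∀ (l : List (Set X)) (U : Set X), IsOpen U → U.Nonempty →
        IsOpen (σ (U :: l)) ∧ (σ (U :: l)).Nonempty ∧ σ (U :: l) ⊆ U) ∧
    (∀ U : ℕ → Set X, (∀ n, IsOpen (U n)) → (∀ n, (U n).Nonempty) →
        (∀ n, U (n + 1) ⊆ σ (((List.range (n + 1)).reverse).map U)) →
        (⋂ n, U n).Nonempty)

/-- Oxtoby's theorem: in a Baire space, the player who moves first has no winning strategy in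
the Choquet game. Here the positions of the game are abstract states `s : S`, with open sets
`V s`, and `r` is the relation of admissible succession. -/
theorem exists_seq_nonempty_iInter_of_baireSpace {Y S : Type*} [TopologicalSpace Y] [BaireSpace Y]
    (V : S → Set Y) (r : S → S → Prop) (hV : ∀ s, IsOpen (V s)) (hne : ∀ s, (V s).Nonempty)
    (hr : ∀ s t, r s t → V t ⊆ V s)
    (hstep : ∀ s W, IsOpen W → W.Nonempty → W ⊆ V s → ∃ t, r s t ∧ V t ⊆ W) (s₀ : S) :
    ∃ s : ℕ → S, s 0 = s₀ ∧ (∀ n, r (s n) (s (n + 1))) ∧ (⋂ n, V (s n)).Nonempty := by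
  have key : ∀ s, ∃ T : Set S, (∀ t ∈ T, r s t) ∧ T.PairwiseDisjoint V ∧
      ∀ W, IsOpen W → W.Nonempty → W ⊆ V s → ∃ t ∈ T, (W ∩ V t).Nonempty := by
    intro s
    obtain ⟨T, hT⟩ := zorn_subset {T : Set S | (∀ t ∈ T, r s t) ∧ T.PairwiseDisjoint V} (by
      intro c hc hchain
      refine ⟨⋃₀ c, ⟨?_, ?_⟩, fun _ h => Set.subset_sUnion_of_mem h⟩
      · rintro t ⟨T, hT, ht⟩
        exact (hc hT).1 t ht
      · exact (Set.pairwiseDisjoint_sUnion hchain.directedOn).2 fun T hT => (hc hT).2)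
    refine ⟨T, hT.prop.1, hT.prop.2, fun W hW hWne hWs => ?_⟩
    by_contra! hcon
    obtain ⟨t, hst, htW⟩ := hstep s W hW hWne hWs
    have hins : insert t T ∈ {T : Set S | (∀ t ∈ T, r s t) ∧ T.PairwiseDisjoint V} := by
      refine ⟨?_, hT.prop.2.insert fun j hj _ => ?_⟩
      · rintro u (rfl | hu)
        exacts [hst, hT.prop.1 u hu]
      · exact (Set.disjoint_iff_inter_eq_empty.2 (hcon j hj)).mono_left htW
    have htT : t ∈ T := hT.le_of_ge hins (Set.subset_insert t T) (Set.mem_insert t T)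
    obtain ⟨y, hy⟩ := hne t
    exact (hcon t htT).subset ⟨htW hy, hy⟩
  choose F hFr hFd hFdense using key
  let L : ℕ → Set S := fun n => Nat.rec {s₀} (fun _ T => {t | ∃ s ∈ T, t ∈ F s}) n
  have hL0 : L 0 = {s₀} := rfl
  have hLs : ∀ n, L (n + 1) = {t | ∃ s ∈ L n, t ∈ F s} := fun _ => rfl
  have huniq : ∀ n, ∀ s ∈ L n, ∀ t ∈ L n, ∀ y, y ∈ V s → y ∈ V t → s = t := by
    intro n
    induction n with
    | zero =>
      intro s hs t ht y _ _
      rw [hL0] at hs ht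
      exact hs.trans ht.symm
    | succ n ih =>
      rintro s ⟨s', hs', hs⟩ t ⟨t', ht', ht⟩ y hys hyt
      obtain rfl := ih s' hs' t' ht' y (hr _ _ (hFr _ _ hs) hys) (hr _ _ (hFr _ _ ht) hyt)
      by_contra hst
      exact Set.disjoint_left.1 (hFd s' hs ht hst) hys hyt
  have hmeet : ∀ n, ∀ W, IsOpen W → W.Nonempty → W ⊆ V s₀ →
      (W ∩ ⋃ s ∈ L n, V s).Nonempty := by
    intro n
    induction n with
    | zero =>
      rintro W - ⟨y, hy⟩ hWs
      exact ⟨y, hy, Set.mem_biUnion (Set.mem_singleton s₀) (hWs hy)⟩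
    | succ n ih =>
      intro W hW hWne hWs
      obtain ⟨y, hyW, hy⟩ := ih W hW hWne hWs
      obtain ⟨s, hs, hys⟩ := Set.mem_iUnion₂.1 hy
      obtain ⟨t, ht, z, hz, hzt⟩ := hFdense s (W ∩ V s) (hW.inter (hV s)) ⟨y, hyW, hys⟩
        Set.inter_subset_right
      exact ⟨z, hz.1, Set.mem_biUnion (show t ∈ L (n + 1) from ⟨s, hs, ht⟩) hzt⟩
  have hdense : Dense (⋂ n, ((⋃ s ∈ L n, V s) ∪ (closure (V s₀))ᶜ)) := by
    refine dense_iInter_of_isOpen_nat (fun n => ?_) (fun n => ?_)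
    · exact (isOpen_biUnion fun s _ => hV s).union isClosed_closure.isOpen_compl
    · refine dense_iff_inter_open.2 fun W hW ⟨y, hy⟩ => ?_
      by_cases hyc : y ∈ closure (V s₀)
      · obtain ⟨z, hz, hz'⟩ := hmeet n (W ∩ V s₀) (hW.inter (hV s₀))
          (mem_closure_iff.1 hyc W hW hy) Set.inter_subset_right
        exact ⟨z, hz.1, Or.inl hz'⟩
      · exact ⟨y, hy, Or.inr hyc⟩
  obtain ⟨y, hy₀, hy⟩ := hdense.inter_open_nonempty _ (hV s₀) (hne s₀)
  have hyL : ∀ n, ∃ s ∈ L n, y ∈ V s := fun n => by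
    rcases Set.mem_iInter.1 hy n with h | h
    · simpa using h
    · exact absurd (subset_closure hy₀) h
  choose s hs hys using hyL
  refine ⟨s, hs 0, fun n => ?_, y, Set.mem_iInter.2 hys⟩
  obtain ⟨t, ht, hst⟩ := hs (n + 1)
  obtain rfl := huniq n t ht (s n) (hs n) y (hr _ _ (hFr _ _ hst) (hys (n + 1))) (hys n)
  exact hFr _ _ hst

/-- A list-valued sequence that starts with `[U 0]` and grows by consing `U (n + 1)` is the
sequence of reversed initial segments of `U`. -/
theorem eq_map_reverse_range_of_cons {α : Type*} (U : ℕ → α) (h : ℕ → List α)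
    (h0 : h 0 = [U 0]) (hs : ∀ n, h (n + 1) = U (n + 1) :: h n) (n : ℕ) :
    h n = ((List.range (n + 1)).reverse).map U := by
  induction n with
  | zero => simp [h0]
  | succ n ih => rw [hs, ih, List.range_succ (n := n + 1)]; simp

/-- The product of an α-favorable space and a Baire space has the Baire property: countably many
dense open sets have a common point. -/
theorem IsAlphaFavorable.nonempty_iInter_of_dense_prod {X Y : Type*} [TopologicalSpace X]
    [TopologicalSpace Y] [Nonempty X] [Nonempty Y] [BaireSpace Y] (hX : IsAlphaFavorable X)
    (G : ℕ → Set (X × Y)) (hG : ∀ n, IsOpen (G n)) (hGd : ∀ n, Dense (G n)) :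
    (⋂ n, G n).Nonempty := by
  obtain ⟨σ, hσ, hwin⟩ := hX
  let S := {p : Set X × List (Set X) × Set Y //
    IsOpen p.1 ∧ p.1.Nonempty ∧ IsOpen p.2.2 ∧ p.2.2.Nonempty}
  let r : S → S → Prop := fun s t => t.1.2.1 = s.1.1 :: s.1.2.1 ∧
    t.1.1 ⊆ σ (s.1.1 :: s.1.2.1) ∧ t.1.2.2 ⊆ s.1.2.2 ∧ t.1.1 ×ˢ t.1.2.2 ⊆ G s.1.2.1.length
  let s₀ : S := ⟨(Set.univ, [], Set.univ), isOpen_univ, Set.univ_nonempty, isOpen_univ,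
    Set.univ_nonempty⟩
  obtain ⟨s, hs0, hs, y, hy⟩ := exists_seq_nonempty_iInter_of_baireSpace
    (fun s : S => s.1.2.2) r (fun s => s.2.2.2.1) (fun s => s.2.2.2.2) (fun s t h => h.2.2.1) (by
      rintro ⟨⟨U, l, V⟩, hU, hUne, hV, hVne⟩ W hW hWne hWV
      obtain ⟨hO, hne, -⟩ := hσ l U hU hUne
      obtain ⟨⟨x, y⟩, hxy, hxyG⟩ := (hGd l.length).inter_open_nonempty _ (hO.prod hW)
        (hne.prod hWne)
      obtain ⟨A, B, hA, hB, hxA, hyB, hAB⟩ := isOpen_prod_iff.1 (hG l.length) x y hxyG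
      refine ⟨⟨(A ∩ σ (U :: l), U :: l, B ∩ W), hA.inter hO, ⟨x, hxA, hxy.1⟩, hB.inter hW,
        ⟨y, hyB, hxy.2⟩⟩, ⟨rfl, Set.inter_subset_right, Set.inter_subset_right.trans hWV, ?_⟩,
        Set.inter_subset_right⟩
      exact (Set.prod_mono Set.inter_subset_left Set.inter_subset_left).trans hAB) s₀
  have hist := eq_map_reverse_range_of_cons (fun n => (s n).1.1)
    (fun n => (s n).1.1 :: (s n).1.2.1) (by simp [hs0, s₀]) (fun n => by simp [(hs n).1])
  have hlen : ∀ n, (s n).1.2.1.length = n := fun n => by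
    simpa using congrArg List.length (hist n)
  obtain ⟨x, hx⟩ := hwin (fun n => (s n).1.1) (fun n => (s n).2.1) (fun n => (s n).2.2.1)
    (fun n => by rw [← hist n]; exact (hs n).2.1)
  refine ⟨(x, y), Set.mem_iInter.2 fun n => ?_⟩
  have h := (hs n).2.2.2
    (Set.mk_mem_prod (Set.mem_iInter.1 hx (n + 1)) (Set.mem_iInter.1 hy (n + 1)))
  rwa [hlen] at h

/-- A real function at a point of discontinuity oscillates across some rational gap. -/
theorem exists_rat_mem_closure_of_not_continuousAt {Z : Type*} [TopologicalSpace Z] {f : Z → ℝ}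
    {p : Z} (hp : ¬ ContinuousAt f p) :
    ∃ a b : ℚ, a < b ∧ p ∈ closure {z | f z < a} ∩ closure {z | (b : ℝ) < f z} := by
  by_contra! hcon
  refine hp (tendsto_order.2 ⟨fun c hc => ?_, fun c hc => ?_⟩)
  · obtain ⟨a, hca, hap⟩ := exists_rat_btwn hc
    obtain ⟨b, hab, hbp⟩ := exists_rat_btwn hap
    have h : p ∉ closure {z | f z < a} := fun h =>
      hcon a b (by exact_mod_cast hab) ⟨h, subset_closure hbp⟩
    filter_upwards [isClosed_closure.isOpen_compl.mem_nhds h] with z hz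
    exact hca.trans_le (not_lt.1 fun hza => hz (subset_closure hza))
  · obtain ⟨b, hpb, hbc⟩ := exists_rat_btwn hc
    obtain ⟨a, hpa, hab⟩ := exists_rat_btwn hpb
    have h : p ∉ closure {z | (b : ℝ) < f z} := fun h =>
      hcon a b (by exact_mod_cast hab) ⟨subset_closure hpa, h⟩
    filter_upwards [isClosed_closure.isOpen_compl.mem_nhds h] with z hz
    exact (not_lt.1 fun hza => hz (subset_closure hza)).trans_lt hbc

/-- A function on the product of an α-favorable and a Baire space which is discontinuous
everywhere oscillates across a fixed gap on every open sub-box of some box. -/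
theorem IsAlphaFavorable.exists_box_oscillation {X Y : Type*} [TopologicalSpace X]
    [TopologicalSpace Y] [Nonempty X] [Nonempty Y] [BaireSpace Y] (hX : IsAlphaFavorable X)
    {f : X × Y → ℝ} (hdisc : ∀ p, ¬ ContinuousAt f p) :
    ∃ (a b : ℝ) (A : Set X) (B : Set Y), a < b ∧ IsOpen A ∧ A.Nonempty ∧ IsOpen B ∧ B.Nonempty ∧
      ∀ U V, IsOpen U → U.Nonempty → U ⊆ A → IsOpen V → V.Nonempty → V ⊆ B →
        (∃ x ∈ U, ∃ y ∈ V, f (x, y) < a) ∧ ∃ x ∈ U, ∃ y ∈ V, b < f (x, y) := by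
  let C : ℚ × ℚ → Set (X × Y) := fun q => {p | q.1 < q.2 ∧
    p ∈ closure {z | f z < q.1} ∩ closure {z | (q.2 : ℝ) < f z}}
  have hC : ∀ q, IsClosed (C q) := fun q => by
    by_cases h : q.1 < q.2
    · simpa [C, h] using isClosed_closure.inter isClosed_closure
    · simp [C, h]
  obtain ⟨q, p, hp⟩ : ∃ q, (interior (C q)).Nonempty := by
    by_contra! hcon
    obtain ⟨e, he⟩ := exists_surjective_nat (ℚ × ℚ)
    obtain ⟨p, hp⟩ := hX.nonempty_iInter_of_dense_prod (fun n => (C (e n))ᶜ)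
      (fun n => (hC _).isOpen_compl) (fun n => interior_eq_empty_iff_dense_compl.1 (hcon _))
    obtain ⟨a, b, hab, h⟩ := exists_rat_mem_closure_of_not_continuousAt (hdisc p)
    obtain ⟨n, hn⟩ := he (a, b)
    refine Set.mem_iInter.1 hp n ?_
    rw [hn]
    exact ⟨hab, h⟩
  obtain ⟨A, B, hA, hB, hxA, hyB, hAB⟩ := isOpen_prod_iff.1 isOpen_interior p.1 p.2 hp
  refine ⟨q.1, q.2, A, B, by exact_mod_cast (interior_subset hp).1, hA, ⟨_, hxA⟩, hB, ⟨_, hyB⟩, ?_⟩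
  rintro U V hU ⟨x, hx⟩ hUA hV ⟨y, hy⟩ hVB
  obtain ⟨-, h₁, h₂⟩ := interior_subset (hAB (Set.mk_mem_prod (hUA hx) (hVB hy)))
  have hUV : IsOpen (U ×ˢ V) := hU.prod hV
  obtain ⟨z, hz, hz'⟩ := mem_closure_iff.1 h₁ _ hUV ⟨hx, hy⟩
  obtain ⟨w, hw, hw'⟩ := mem_closure_iff.1 h₂ _ hUV ⟨hx, hy⟩
  exact ⟨⟨z.1, hz.1, z.2, hz.2, hz'⟩, ⟨w.1, hw.1, w.2, hw.2, hw'⟩⟩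

/-- If `f` is continuous in the second variable and oscillates on every sub-box of `A × B`, then
finitely many open subsets of `A` can be split by a common point of `B`. -/
theorem exists_common_oscillation {X Y ι : Type*} [TopologicalSpace X] [TopologicalSpace Y]
    {f : X × Y → ℝ} (hc : ∀ x, Continuous fun y => f (x, y)) {a b : ℝ} {A : Set X} {B : Set Y}
    (hosc : ∀ U V, IsOpen U → U.Nonempty → U ⊆ A → IsOpen V → V.Nonempty → V ⊆ B →
        (∃ x ∈ U, ∃ y ∈ V, f (x, y) < a) ∧ ∃ x ∈ U, ∃ y ∈ V, b < f (x, y))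
    (hB : IsOpen B) (hBne : B.Nonempty) {s : Set ι} (hs : s.Finite) (W : ι → Set X)
    (hW : ∀ i ∈ s, IsOpen (W i) ∧ (W i).Nonempty ∧ W i ⊆ A) :
    ∃ y, ∀ i ∈ s, (∃ x ∈ W i, f (x, y) < a) ∧ ∃ x ∈ W i, b < f (x, y) := by
  suffices h : ∃ V, IsOpen V ∧ V.Nonempty ∧ V ⊆ B ∧ ∀ y ∈ V, ∀ i ∈ s,
      (∃ x ∈ W i, f (x, y) < a) ∧ ∃ x ∈ W i, b < f (x, y) by
    obtain ⟨V, -, ⟨y, hy⟩, -, h⟩ := h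
    exact ⟨y, h y hy⟩
  induction s, hs using Set.Finite.induction_on with
  | empty => exact ⟨B, hB, hBne, subset_rfl, by simp⟩
  | @insert i s _ _ ih =>
    obtain ⟨V, hV, hVne, hVB, h⟩ := ih fun j hj => hW j (Set.mem_insert_of_mem _ hj)
    obtain ⟨hWo, hWne, hWA⟩ := hW i (Set.mem_insert _ _)
    obtain ⟨x₁, hx₁, y₁, hy₁, hf₁⟩ := (hosc _ V hWo hWne hWA hV hVne hVB).1
    have hV₁ : IsOpen (V ∩ {y | f (x₁, y) < a}) := hV.inter (isOpen_lt (hc x₁) continuous_const)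
    obtain ⟨x₂, hx₂, y₂, hy₂, hf₂⟩ := (hosc _ _ hWo hWne hWA hV₁ ⟨y₁, hy₁, hf₁⟩
      (Set.inter_subset_left.trans hVB)).2
    refine ⟨V ∩ {y | f (x₁, y) < a} ∩ {y | b < f (x₂, y)},
      hV₁.inter (isOpen_lt continuous_const (hc x₂)), ⟨y₂, hy₂, hf₂⟩,
      fun y hy => hVB hy.1.1, ?_⟩
    rintro y ⟨⟨hyV, hy₁⟩, hy₂⟩ j (rfl | hj)
    · exact ⟨⟨x₁, hx₁, hy₁⟩, ⟨x₂, hx₂, hy₂⟩⟩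
    · exact h y hyV j hj

/-- A quasicontinuous map that sends a point of an open set `W` into an open set `V` sends a
nonempty open subset of `W` into `V`. -/
theorem IsQuasicontinuous.exists_isOpen_subset {X Z : Type*} [TopologicalSpace X]
    [TopologicalSpace Z] {f : X → Z} (hf : IsQuasicontinuous f) {W : Set X} {V : Set Z}
    (hW : IsOpen W) (hV : IsOpen V) (h : ∃ x ∈ W, f x ∈ V) :
    ∃ U, IsOpen U ∧ U.Nonempty ∧ U ⊆ W ∧ ∀ x ∈ U, f x ∈ V := by
  obtain ⟨x, hx, hxV⟩ := h
  exact hf x W (hW.mem_nhds hx) V (hV.mem_nhds hxV)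

/-- A quasicontinuous/continuous function on the product of an α-favorable and a Baire space which
is discontinuous everywhere has an independent sequence of vertical sections. -/
theorem IsAlphaFavorable.exists_independent_seq {X Y : Type*} [TopologicalSpace X]
    [TopologicalSpace Y] [Nonempty X] [Nonempty Y] [BaireSpace Y] (hX : IsAlphaFavorable X)
    {f : X × Y → ℝ} (hq : ∀ y, IsQuasicontinuous fun x => f (x, y))
    (hc : ∀ x, Continuous fun y => f (x, y)) (hdisc : ∀ p, ¬ ContinuousAt f p) :
    ∃ (a b : ℝ) (y : ℕ → Y), a < b ∧ ∀ N : Set ℕ, ∃ x,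
      (∀ n ∈ N, b < f (x, y n)) ∧ ∀ n ∉ N, f (x, y n) < a := by
  classical
  obtain ⟨a, b, A, B, hab, hA, hAne, hB, hBne, hosc⟩ := hX.exists_box_oscillation hdisc
  obtain ⟨σ, hσ, hwin⟩ := hX
  let Good : List (Set X) → Prop := fun h =>
    ∃ U l, h = U :: l ∧ IsOpen U ∧ U.Nonempty ∧ U ⊆ A
  have hgood : ∀ h, Good h → IsOpen (σ h) ∧ (σ h).Nonempty ∧ σ h ⊆ A := by
    rintro _ ⟨U, l, rfl, hU, hUne, hUA⟩
    obtain ⟨h₁, h₂, h₃⟩ := hσ l U hU hUne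
    exact ⟨h₁, h₂, h₃.trans hUA⟩
  have hstep : ∀ F : Set (List (Set X)), ∃ (y : Y) (Φ : List (Set X) → Prop → Set X),
      F.Finite → (∀ h ∈ F, Good h) → ∀ h ∈ F,
        (∀ c, IsOpen (Φ h c) ∧ (Φ h c).Nonempty ∧ Φ h c ⊆ σ h) ∧
        (∀ x ∈ Φ h True, b < f (x, y)) ∧ ∀ x ∈ Φ h False, f (x, y) < a := by
    intro F
    by_cases hF : F.Finite ∧ ∀ h ∈ F, Good h
    swap
    · exact ⟨Classical.arbitrary Y, fun _ _ => ∅, fun h₁ h₂ => absurd ⟨h₁, h₂⟩ hF⟩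
    obtain ⟨y, hy⟩ := exists_common_oscillation hc hosc hB hBne hF.1 σ
      fun h hh => hgood h (hF.2 h hh)
    have hex : ∀ (h : List (Set X)) (c : Prop), ∃ U : Set X, h ∈ F →
        (IsOpen U ∧ U.Nonempty ∧ U ⊆ σ h) ∧ ∀ x ∈ U, if c then b < f (x, y) else f (x, y) < a := by
      intro h c
      by_cases hh : h ∈ F
      swap
      · exact ⟨∅, fun h' => absurd h' hh⟩
      have hWo := (hgood h (hF.2 h hh)).1
      by_cases hc' : c
      · obtain ⟨U, h₁, h₂, h₃, h₄⟩ := (hq y).exists_isOpen_subset hWo isOpen_Ioi (hy h hh).2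
        exact ⟨U, fun _ => ⟨⟨h₁, h₂, h₃⟩, by simpa [hc'] using h₄⟩⟩
      · obtain ⟨U, h₁, h₂, h₃, h₄⟩ := (hq y).exists_isOpen_subset hWo isOpen_Iio (hy h hh).1
        exact ⟨U, fun _ => ⟨⟨h₁, h₂, h₃⟩, by simpa [hc'] using h₄⟩⟩
    choose Φ hΦ using hex
    refine ⟨y, Φ, fun _ _ h hh => ⟨fun c => (hΦ h c hh).1, ?_, ?_⟩⟩
    · simpa using (hΦ h True hh).2
    · simpa using (hΦ h False hh).2
  choose y Φ hΦ using hstep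
  let next : Set (List (Set X)) → Set (List (Set X)) := fun F =>
    (fun p : List (Set X) × Prop => Φ F p.1 p.2 :: p.1) '' (F ×ˢ Set.univ)
  let F : ℕ → Set (List (Set X)) := fun n => Nat.rec {[A]} (fun _ F => next F) n
  have hFs : ∀ n, F (n + 1) = next (F n) := fun _ => rfl
  have hF : ∀ n, (F n).Finite ∧ ∀ h ∈ F n, Good h := by
    intro n
    induction n with
    | zero =>
      refine ⟨Set.finite_singleton _, ?_⟩
      rintro _ rfl
      exact ⟨A, [], rfl, hA, hAne, subset_rfl⟩
    | succ n ih =>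
      rw [hFs]
      refine ⟨(ih.1.prod Set.finite_univ).image _, ?_⟩
      rintro _ ⟨⟨h, c⟩, ⟨hh, -⟩, rfl⟩
      obtain ⟨h₁, h₂, h₃⟩ := (hΦ (F n) ih.1 ih.2 h hh).1 c
      exact ⟨_, h, rfl, h₁, h₂, h₃.trans (hgood h (ih.2 h hh)).2.2⟩
  refine ⟨a, b, fun n => y (F n), hab, fun N => ?_⟩
  let H : ℕ → List (Set X) := fun n =>
    Nat.rec [A] (fun n h => Φ (F n) h (n ∈ N) :: h) n
  let U : ℕ → Set X := fun n => Nat.casesOn n A fun n => Φ (F n) (H n) (n ∈ N)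
  have hHF : ∀ n, H n ∈ F n := by
    intro n
    induction n with
    | zero => exact Set.mem_singleton _
    | succ n ih => exact ⟨(H n, n ∈ N), ⟨ih, Set.mem_univ _⟩, rfl⟩
  have hsplit := fun n => hΦ (F n) (hF n).1 (hF n).2 (H n) (hHF n)
  have hUs : ∀ n, U (n + 1) = Φ (F n) (H n) (n ∈ N) := fun _ => rfl
  have hist := eq_map_reverse_range_of_cons U H rfl fun _ => rfl
  have hU : ∀ n, IsOpen (U n) ∧ (U n).Nonempty
    | 0 => ⟨hA, hAne⟩
    | n + 1 => ⟨((hsplit n).1 _).1, ((hsplit n).1 _).2.1⟩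
  obtain ⟨x, hx⟩ := hwin U (fun n => (hU n).1) (fun n => (hU n).2) fun n => by
    rw [← hist n]
    exact ((hsplit n).1 _).2.2
  refine ⟨x, fun n hn => ?_, fun n hn => ?_⟩
  · have h := Set.mem_iInter.1 hx (n + 1)
    rw [hUs, eq_true hn] at h
    exact (hsplit n).2.1 x h
  · have h := Set.mem_iInter.1 hx (n + 1)
    rw [hUs, eq_false hn] at h
    exact (hsplit n).2.2 x h

theorem stmt1 {X Y : Type*} [TopologicalSpace X] [TopologicalSpace Y]
    [Nonempty X] [Nonempty Y] [BaireSpace Y]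
    (hX : IsAlphaFavorable X) (f : X × Y → ℝ)
    (hq : ∀ y : Y, IsQuasicontinuous fun x => f (x, y))
    (hc : ∀ x : X, Continuous fun y => f (x, y))
    (hdisc : ∀ p : X × Y, ¬ ContinuousAt f p) :
    ∃ y : ℕ → Y, ∀ N : Set ℕ, ∃ g : Y → ℝ, Continuous g ∧
      (∀ t : Y, g t ∈ Set.Icc (0 : ℝ) 1) ∧
      (∀ n ∈ N, g (y n) = 1) ∧ (∀ n ∉ N, g (y n) = 0) := by
  obtain ⟨a, b, y, hab, hy⟩ := hX.exists_independent_seq hq hc hdisc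
  have hba : 0 < b - a := sub_pos.2 hab
  refine ⟨y, fun N => ?_⟩
  obtain ⟨x, hx₁, hx₀⟩ := hy N
  refine ⟨fun t => max 0 (min 1 ((f (x, t) - a) / (b - a))), ?_, fun t => ?_, fun n hn => ?_,
    fun n hn => ?_⟩
  · exact continuous_const.max
      (continuous_const.min (((hc x).sub continuous_const).div_const _))
  · exact ⟨le_max_left _ _, max_le zero_le_one (min_le_left _ _)⟩
  · have h : 1 ≤ (f (x, y n) - a) / (b - a) := by
      rw [one_le_div hba]
      linarith [hx₁ n hn]
    simp [min_eq_left h]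
  · have h : (f (x, y n) - a) / (b - a) ≤ 0 :=
      div_nonpos_of_nonpos_of_nonneg (by linarith [hx₀ n hn]) hba.le
    exact max_eq_left ((min_le_right _ _).trans h)
end

section
/- Let Y = βℕ \ ℕ and X = C_p(Y, {0,1}) the space of continuous functions Y → {0,1} with the topology of pointwise convergence. If X is not a Baire space, then there exists a sequence (Eₙ) of nonempty finite pairwise disjoint subsets of Y which weakly converges to some point y₀ ∈ Y. -/
/-- The remainder `βℕ \ ℕ`, realized as the subspace of free ultrafilters in `Ultrafilter ℕ`. -/
abbrev OmegaStar : Type := {x : Ultrafilter ℕ // x ∉ Set.range (pure : ℕ → Ultrafilter ℕ)}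

/-- `C_p(βℕ \ ℕ, {0,1})`: continuous functions to `{0,1}` (realized as `Bool`) with the
topology of pointwise convergence (the subspace topology of the product topology). -/
abbrev Cp : Type := {x : OmegaStar → Bool // Continuous x}

/-- A sequence of sets `(Aₙ)` weakly converges to `y₀` if every neighborhood of `y₀`
meets `Aₙ` for all sufficiently large `n`. -/
def WeaklyConverges {Y : Type*} [TopologicalSpace Y] (A : ℕ → Set Y) (y₀ : Y) : Prop :=
  ∀ U ∈ nhds y₀, ∃ n₀ : ℕ, ∀ n ≥ n₀, (U ∩ A n).Nonempty

/-- The basic clopen subset of `βℕ \ ℕ` determined by a set of natural numbers. -/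
def OmegaStar.basicSet (s : Set ℕ) : Set OmegaStar := {u | s ∈ u.1}

namespace OmegaStar

theorem basicSet_union (s t : Set ℕ) : basicSet (s ∪ t) = basicSet s ∪ basicSet t := by
  ext u
  exact Ultrafilter.union_mem_iff

theorem isOpen_basicSet (s : Set ℕ) : IsOpen (basicSet s) :=
  (ultrafilter_isOpen_basic s).preimage continuous_subtype_val

theorem isClosed_basicSet (s : Set ℕ) : IsClosed (basicSet s) :=
  (ultrafilter_isClosed_basic s).preimage continuous_subtype_val

theorem exists_basicSet_subset {a : OmegaStar} {U : Set OmegaStar} (hU : U ∈ nhds a) :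
    ∃ s, a ∈ basicSet s ∧ basicSet s ⊆ U := by
  rw [nhds_subtype_eq_comap, Filter.mem_comap] at hU
  obtain ⟨V, hV, hVU⟩ := hU
  obtain ⟨_, ⟨s, rfl⟩, has, hsV⟩ := ultrafilterBasis_is_basis.mem_nhds_iff.1 hV
  exact ⟨s, has, fun u hu => hVU (hsV hu)⟩

/-- A finite set of free ultrafilters is shattered by the basic clopen sets. -/
theorem exists_set_mem_iff (S : Finset OmegaStar) (P : OmegaStar → Prop) :
    ∃ t : Set ℕ, ∀ a ∈ S, (a ∈ basicSet t ↔ P a) := by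
  classical
  induction S using Finset.induction_on with
  | empty => exact ⟨∅, by simp⟩
  | insert a S ha ih =>
    obtain ⟨t, ht⟩ := ih
    obtain ⟨w, haw, hw⟩ := exists_basicSet_subset
      (S.finite_toSet.isClosed.isOpen_compl.mem_nhds (show a ∈ (S : Set OmegaStar)ᶜ from ha))
    have hS : ∀ b ∈ S, b ∉ basicSet w := fun b hb hbw => hw hbw hb
    by_cases hP : P a
    · refine ⟨t ∪ w, fun b hb => ?_⟩
      rw [basicSet_union]
      rcases Finset.mem_insert.1 hb with rfl | hb
      · exact ⟨fun _ => hP, fun _ => Or.inr haw⟩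
      · rw [← ht b hb]
        exact ⟨fun h => h.resolve_right (hS b hb), Or.inl⟩
    · refine ⟨t \ w, fun b hb => ?_⟩
      have hdiff : b ∈ basicSet (t \ w) ↔ b ∈ basicSet t ∧ b ∉ basicSet w :=
        Ultrafilter.sdiff_mem_iff b.1
      rw [hdiff]
      rcases Finset.mem_insert.1 hb with rfl | hb
      · exact ⟨fun h => absurd haw h.2, fun h => absurd h hP⟩
      · rw [← ht b hb]
        exact ⟨fun h => h.1, fun h => ⟨h, hS b hb⟩⟩

end OmegaStar

namespace Cp

open OmegaStar

/-- The continuous indicator function of a basic clopen set. -/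
noncomputable def indicator (t : Set ℕ) : Cp := by
  classical
  exact ⟨fun a => decide (a ∈ basicSet t), by
    rw [continuous_bool_rng true]
    have hpre : (fun a => decide (a ∈ basicSet t)) ⁻¹' {true} = basicSet t := by
      ext a
      simp
    rw [hpre]
    exact ⟨isClosed_basicSet t, isOpen_basicSet t⟩⟩

theorem indicator_apply_eq_true {t : Set ℕ} {a : OmegaStar} :
    (indicator t).1 a = true ↔ a ∈ basicSet t := by
  simp [indicator]

theorem exists_agree (S : Finset OmegaStar) (g : OmegaStar → Bool) :
    ∃ x : Cp, ∀ a ∈ S, x.1 a = g a := by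
  obtain ⟨t, ht⟩ := exists_set_mem_iff S (fun a => g a = true)
  refine ⟨indicator t, fun a ha => ?_⟩
  rw [Bool.eq_iff_iff, indicator_apply_eq_true, ht a ha]

theorem isOpen_agree (S : Finset OmegaStar) (g : OmegaStar → Bool) :
    IsOpen {x : Cp | ∀ a ∈ S, x.1 a = g a} := by
  have : {x : Cp | ∀ a ∈ S, x.1 a = g a} = ⋂ a ∈ S, (fun x : Cp => x.1 a) ⁻¹' {g a} := by
    ext x
    simp
  rw [this]
  exact isOpen_biInter_finset fun a _ =>
    (isOpen_discrete _).preimage ((continuous_apply a).comp continuous_subtype_val)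

theorem exists_finset_agree {G : Set Cp} (hG : IsOpen G) {x : Cp} (hx : x ∈ G) :
    ∃ H : Finset OmegaStar, ∀ z : Cp, (∀ a ∈ H, z.1 a = x.1 a) → z ∈ G := by
  obtain ⟨V, hV, rfl⟩ := isOpen_induced_iff.1 hG
  obtain ⟨H, u, hu, huV⟩ := isOpen_pi_iff.1 hV x.1 hx
  refine ⟨H, fun z hz => huV fun a ha => ?_⟩
  rw [hz a ha]
  exact (hu a ha).2

/-- Given a dense open set `G` and a finite set `F` of coordinates, membership in `G` can be
forced by finitely many conditions on coordinates outside `F`. -/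
theorem exists_disjoint_forcing {G : Set Cp} (hG : IsOpen G) (hd : Dense G)
    (F : Finset OmegaStar) :
    ∃ (E : Finset OmegaStar) (y : Cp), Disjoint F E ∧
      ∀ x : Cp, (∀ a ∈ E, x.1 a = y.1 a) → x ∈ G := by
  classical
  have key : ∀ T : Finset (F → Bool), ∃ (E : Finset OmegaStar) (y : Cp), Disjoint F E ∧
      ∀ x : Cp, (fun a : F => x.1 a) ∈ T → (∀ a ∈ E, x.1 a = y.1 a) → x ∈ G := by
    intro T
    induction T using Finset.induction_on with
    | empty => exact ⟨∅, indicator ∅, by simp, by simp⟩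
    | insert s T _ ih =>
      obtain ⟨E, y, hFE, hE⟩ := ih
      let g : OmegaStar → Bool := fun a => if h : a ∈ F then s ⟨a, h⟩ else y.1 a
      obtain ⟨w, hw, hwG⟩ := hd.inter_open_nonempty _ (isOpen_agree (F ∪ E) g)
        (exists_agree (F ∪ E) g)
      obtain ⟨H, hH⟩ := exists_finset_agree hG hwG
      have hwF : ∀ a (ha : a ∈ F), w.1 a = s ⟨a, ha⟩ := fun a ha => by
        rw [hw a (Finset.mem_union_left _ ha)]
        simp [g, ha]
      have hwE : ∀ a ∈ E, w.1 a = y.1 a := fun a ha => by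
        rw [hw a (Finset.mem_union_right _ ha)]
        simp [g, Finset.disjoint_right.1 hFE ha]
      refine ⟨E ∪ (H \ F), w, ?_, fun x hxT hxE => ?_⟩
      · exact Finset.disjoint_union_right.2 ⟨hFE, Finset.disjoint_sdiff⟩
      rcases Finset.mem_insert.1 hxT with hxs | hxT
      · refine hH x fun a ha => ?_
        by_cases haF : a ∈ F
        · rw [hwF a haF, ← hxs]
        · exact hxE a (by simp [ha, haF])
      · exact hE x hxT fun a ha => by rw [hxE a (Finset.mem_union_left _ ha), hwE a ha]
  obtain ⟨E, y, hFE, hE⟩ := key Finset.univ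
  exact ⟨E, y, hFE, fun x => hE x (Finset.mem_univ _)⟩

/-- If `Cp` is not Baire, some sequence of disjoint finite conditions cannot be met infinitely
often, together with the first of them, by a continuous function. -/
theorem exists_forcing_seq (h : ¬ BaireSpace Cp) :
    ∃ (E : ℕ → Finset OmegaStar) (y : ℕ → Cp), Pairwise (Function.onFun Disjoint E) ∧
      ∀ (x : Cp) (n : ℕ → ℕ), n 0 = 0 → StrictMono n →
        ¬ ∀ k, ∀ a ∈ E (n k), x.1 a = (y (n k)).1 a := by
  classical
  have h' : ∃ f : ℕ → Set Cp, (∀ n, IsOpen (f n)) ∧ (∀ n, Dense (f n)) ∧ ¬ Dense (⋂ n, f n) := by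
    by_contra! hc
    exact h ⟨hc⟩
  obtain ⟨f, hfo, hfd, hf⟩ := h'
  have hfin : ∀ n, IsOpen (⋂ i ∈ Finset.range n, f i) ∧ Dense (⋂ i ∈ Finset.range n, f i) := by
    intro n
    refine ⟨isOpen_biInter_finset fun i _ => hfo i, ?_⟩
    induction n with
    | zero => simp
    | succ n ih =>
      rw [Finset.range_add_one, Finset.set_biInter_insert]
      exact (hfd n).inter_of_isOpen_left ih (hfo n)
  obtain ⟨O, hO, ⟨x₀, hx₀⟩, hOf⟩ : ∃ O : Set Cp, IsOpen O ∧ O.Nonempty ∧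
      ¬ (O ∩ ⋂ n, f n).Nonempty := by
    by_contra! hc
    exact hf (dense_iff_inter_open.2 hc)
  obtain ⟨S, hS⟩ := exists_finset_agree hO hx₀
  choose e y hdisj hforce using fun (n : ℕ) (F : Finset OmegaStar) =>
    exists_disjoint_forcing (hfin n).1 (hfin n).2 F
  let F : ℕ → Finset OmegaStar := fun n => Nat.rec S (fun k A => A ∪ e k A) n
  have hFmono : Monotone F := monotone_nat_of_le_succ fun n => Finset.subset_union_left
  let E : ℕ → Finset OmegaStar := fun n => Nat.casesOn n S fun k => e k (F k)
  have hEF : ∀ n, E n ⊆ F n := by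
    rintro (_ | n)
    · exact subset_rfl
    · exact Finset.subset_union_right
  refine ⟨E, fun n => Nat.casesOn n x₀ fun k => y k (F k), ?_, fun x n hn0 hn hx => ?_⟩
  · refine (pairwise_disjoint_on E).2 fun m n hmn => ?_
    obtain ⟨k, rfl⟩ := Nat.exists_eq_succ_of_ne_zero (Nat.ne_zero_of_lt hmn)
    exact (hdisj k (F k)).mono_left ((hEF m).trans (hFmono (Nat.lt_succ_iff.1 hmn)))
  · refine hOf ⟨x, hS x ?_, Set.mem_iInter.2 fun i => ?_⟩
    · have := hx 0
      rw [hn0] at this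
      exact this
    · have hlt : i + 1 < n (i + 2) := Nat.lt_of_succ_le (hn.id_le (i + 2))
      obtain ⟨k, hk⟩ := Nat.exists_eq_succ_of_ne_zero (Nat.ne_zero_of_lt hlt)
      have hxk := hx (i + 2)
      rw [hk] at hxk
      exact Set.mem_iInter₂.1 (hforce k (F k) x hxk) i (Finset.mem_range.2 (by omega))

end Cp

namespace OmegaStar

/-- A sequence of finite sets all of whose subsequences avoid some neighborhood of each point
has a subsequence which is discretely separated by basic clopen sets. -/
theorem exists_separated_subseq {E : ℕ → Finset OmegaStar}
    (hE : ∀ (a : OmegaStar) (N : Set ℕ), N.Infinite →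
      ∃ U ∈ nhds a, {n ∈ N | Disjoint U (E n : Set OmegaStar)}.Infinite) :
    ∃ (n : ℕ → ℕ) (s : ℕ → Set ℕ), n 0 = 0 ∧ StrictMono n ∧
      (∀ k, ∀ a ∈ E (n k), a ∈ basicSet (s k)) ∧
      ∀ j k, j < k → ∀ a ∈ E (n k), a ∉ basicSet (s j) := by
  classical
  have hfin : ∀ (A : Finset OmegaStar) (N : Set ℕ), N.Infinite → ∃ s : Set ℕ,
      (∀ a ∈ A, a ∈ basicSet s) ∧ {n ∈ N | ∀ a ∈ E n, a ∉ basicSet s}.Infinite := by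
    intro A N hN
    induction A using Finset.induction_on with
    | empty => exact ⟨∅, by simp, by simpa [basicSet] using hN⟩
    | insert b A _ ih =>
      obtain ⟨s, hs, hsN⟩ := ih
      obtain ⟨U, hU, hUN⟩ := hE b _ hsN
      obtain ⟨t, hbt, htU⟩ := exists_basicSet_subset hU
      refine ⟨s ∪ t, fun a ha => ?_, hUN.mono ?_⟩
      · rw [basicSet_union]
        rcases Finset.mem_insert.1 ha with rfl | ha
        · exact Or.inr hbt
        · exact Or.inl (hs a ha)
      · rintro n ⟨⟨hnN, hns⟩, hnU⟩
        refine ⟨hnN, fun a ha => ?_⟩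
        rw [basicSet_union]
        rintro (has | hat)
        · exact hns a ha has
        · exact Set.disjoint_left.1 hnU (htU hat) ha
  have hstep : ∀ N : {N : Set ℕ // N.Infinite}, ∃ (M : {N : Set ℕ // N.Infinite}) (s : Set ℕ),
      (∀ a ∈ E (sInf N.1), a ∈ basicSet s) ∧ M.1 ⊆ N.1 ∧ (∀ n ∈ M.1, sInf N.1 < n) ∧
      ∀ n ∈ M.1, ∀ a ∈ E n, a ∉ basicSet s := by
    rintro ⟨N, hN⟩
    obtain ⟨s, hs, hsN⟩ := hfin (E (sInf N)) N hN
    refine ⟨⟨_, hsN.sdiff (Set.finite_Iic (sInf N))⟩, s, hs, fun n hn => hn.1.1,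
      fun n hn => not_le.1 hn.2, fun n hn => hn.1.2⟩
  choose M s hs hMsub hMlt hMs using hstep
  let N : ℕ → {N : Set ℕ // N.Infinite} := fun k => Nat.rec ⟨Set.univ, Set.infinite_univ⟩
    (fun _ A => M A) k
  have hanti : Antitone fun k => (N k).1 := antitone_nat_of_succ_le fun k => hMsub (N k)
  have hmem : ∀ k, sInf (N k).1 ∈ (N k).1 := fun k => Nat.sInf_mem (N k).2.nonempty
  refine ⟨fun k => sInf (N k).1, fun k => s (N k), ?_, ?_, fun k => hs (N k), ?_⟩
  · exact Nat.sInf_eq_zero.2 (Or.inl (Set.mem_univ _))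
  · exact strictMono_nat_of_lt_succ fun k => hMlt (N k) _ (hmem (k + 1))
  · exact fun j k hjk => hMs (N j) _ (hanti (Nat.succ_le_of_lt hjk) (hmem k))

/-- Arbitrary basic clopen sets can be glued along a separated sequence. -/
theorem exists_glue {A : ℕ → Finset OmegaStar} {s : ℕ → Set ℕ}
    (hs : ∀ k, ∀ a ∈ A k, a ∈ basicSet (s k))
    (hd : ∀ j k, j < k → ∀ a ∈ A k, a ∉ basicSet (s j)) (t : ℕ → Set ℕ) :
    ∃ w : Set ℕ, ∀ k, ∀ a ∈ A k, (a ∈ basicSet w ↔ a ∈ basicSet (t k)) := by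
  refine ⟨⋃ k, disjointed s k ∩ t k, fun k a ha => ?_⟩
  have hk : disjointed s k ∈ a.1 := by
    rw [disjointed_eq_inter_compl]
    refine Filter.inter_mem (hs k a ha) ((Filter.biInter_mem (Set.finite_Iio k)).2 fun j hj => ?_)
    exact Ultrafilter.compl_mem_iff_notMem.2 (hd j k hj a ha)
  have heq : ∀ i ∈ disjointed s k, (i ∈ ⋃ k, disjointed s k ∩ t k) ↔ i ∈ t k := by
    intro i hi
    refine ⟨fun h => ?_, fun h => Set.mem_iUnion.2 ⟨k, hi, h⟩⟩
    obtain ⟨j, hij, hit⟩ := Set.mem_iUnion.1 h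
    obtain rfl : j = k := by
      by_contra hne
      exact Set.disjoint_left.1 (disjoint_disjointed s hne) hij hi
    exact hit
  exact ⟨fun h => Filter.mem_of_superset (Filter.inter_mem h hk) fun i hi => (heq i hi.2).1 hi.1,
    fun h => Filter.mem_of_superset (Filter.inter_mem h hk) fun i hi => (heq i hi.2).2 hi.1⟩

end OmegaStar

theorem stmt13 (h : ¬ BaireSpace Cp) :
    ∃ (E : ℕ → Set OmegaStar) (y₀ : OmegaStar),
      (∀ n, (E n).Finite) ∧ (∀ n, (E n).Nonempty) ∧
      Pairwise (Function.onFun Disjoint E) ∧ WeaklyConverges E y₀ := by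
  classical
  obtain ⟨E, y, hE, hy⟩ := Cp.exists_forcing_seq h
  by_contra hno
  have hav : ∀ (a : OmegaStar) (N : Set ℕ), N.Infinite →
      ∃ U ∈ nhds a, {n ∈ N | Disjoint U (E n : Set OmegaStar)}.Infinite := by
    intro a N hN
    by_contra! hc
    have hN' : {n ∈ N | (E n).Nonempty}.Infinite := by
      refine (hN.sdiff (hc Set.univ Filter.univ_mem)).mono fun n hn => ⟨hn.1, ?_⟩
      by_contra hne
      exact hn.2 ⟨hn.1, by simp [Finset.not_nonempty_iff_eq_empty.1 hne]⟩
    have hmem := fun k => Nat.nth_mem_of_infinite hN' k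
    have hmono := Nat.nth_strictMono hN'
    refine hno ⟨fun k => E (Nat.nth _ k), a, fun k => Finset.finite_toSet _,
      fun k => (hmem k).2, fun i j hij => ?_, fun U hU => ?_⟩
    · exact Finset.disjoint_coe.2 (hE (hmono.injective.ne hij))
    · obtain ⟨b, hb⟩ := (hc U hU).bddAbove
      refine ⟨b + 1, fun k hk => ?_⟩
      by_contra hne
      have hle := hb ⟨(hmem k).1, Set.disjoint_iff_inter_eq_empty.2
        (Set.not_nonempty_iff_eq_empty.1 hne)⟩
      have := hmono.id_le k
      simp only [id] at this
      omega
  obtain ⟨n, s, hn0, hn, hs, hd⟩ := OmegaStar.exists_separated_subseq hav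
  choose t ht using fun k =>
    OmegaStar.exists_set_mem_iff (E (n k)) (fun a => (y (n k)).1 a = true)
  obtain ⟨w, hw⟩ := OmegaStar.exists_glue hs hd t
  refine hy (Cp.indicator w) n hn0 hn fun k a ha => ?_
  rw [Bool.eq_iff_iff, Cp.indicator_apply_eq_true, hw k a ha, ht k a ha]
end
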